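/- arXiv:2004.14504 — 3 statements merged into one kernel-verified Lean document; each statement's English description precedes it below -/
import Mathlib

section
/- Let ρ be a d×d density matrix (positive semidefinite with trace 1) and let x be a Hermitian d×d matrix. If x is not a density matrix (i.e. x is not positive semidefinite with trace 1), then I_ρ(x) = ∞. (For the standard representation of U(d), the convex hull of the weights is the probability simplex, and its saturation under unitary conjugation is exactly the set of density matrices.) -/
open Matrix
open scoped ComplexOrder

noncomputable section
open scoped Classical

/-- Square complex matrices of size `d`. -/
abbrev Mat (d : ℕ) := Matrix (Fin d) (Fin d) ℂ

/-- `n` is upper triangular with all diagonal entries equal to `1`. -/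
def IsUnitUpperTriangular {d : ℕ} (n : Mat d) : Prop :=
  n.BlockTriangular (id : Fin d → Fin d) ∧ ∀ i, n i i = 1

/-- `a` is diagonal with positive real diagonal entries. -/
def IsPosDiagonal {d : ℕ} (a : Mat d) : Prop :=
  ∃ f : Fin d → ℝ, (∀ i, 0 < f i) ∧ a = Matrix.diagonal (fun i => (f i : ℂ))

/-- `(k, a, n)` is an Iwasawa (QR) decomposition of `g`: `g = k a n` with `k` unitary,
`a` diagonal with positive real diagonal entries and `n` unit upper triangular. -/
def IsIwasawa {d : ℕ} (g k a n : Mat d) : Prop :=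
  g = k * a * n ∧ k ∈ Matrix.unitaryGroup (Fin d) ℂ ∧ IsPosDiagonal a ∧ IsUnitUpperTriangular n

/-- A choice of the (unique) Iwasawa decomposition `(k(g), a(g), n(g))` of `g`. -/
def iwaTriple {d : ℕ} (g : Mat d) : Mat d × Mat d × Mat d :=
  if h : ∃ t : Mat d × Mat d × Mat d, IsIwasawa g t.1 t.2.1 t.2.2 then h.choose else (1, 1, 1)

/-- The unitary factor `k(g)` in the Iwasawa decomposition of `g`. -/
def iwaK {d : ℕ} (g : Mat d) : Mat d := (iwaTriple g).1

/-- `α(g) = log a(g)`, a real diagonal matrix. -/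
def iwaAlpha {d : ℕ} (g : Mat d) : Matrix (Fin d) (Fin d) ℝ :=
  Matrix.diagonal (fun i => Real.log (((iwaTriple g).2.1 i i).re))

/-- `x = h * diagonal f * h*` with `h` unitary and `f` real and nonincreasing. -/
def IsOrderedDiagonalization {d : ℕ} (x : Mat d) (h : Mat d) (f : Fin d → ℝ) : Prop :=
  h ∈ Matrix.unitaryGroup (Fin d) ℂ ∧ Antitone f ∧
    x = h * Matrix.diagonal (fun i => (f i : ℂ)) * star h

/-- A choice of an ordered spectral decomposition `x = h x₀ h*` of a hermitian matrix. -/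
def specPair {d : ℕ} (x : Mat d) : Mat d × (Fin d → ℝ) :=
  if h : ∃ p : Mat d × (Fin d → ℝ), IsOrderedDiagonalization x p.1 p.2 then h.choose else (1, 0)

/-- `χ_x(g) = exp (2 Tr (x₀ α(g h)))` where `x = h x₀ h*` (independent of the choice of `h`). -/
def chi {d : ℕ} (x g : Mat d) : ℝ :=
  Real.exp (2 * Matrix.trace (Matrix.diagonal (specPair x).2 * iwaAlpha (g * (specPair x).1)))

/-- The rate function `I_ρ(x) = sup_{g ∈ GL(d,ℂ)} (-ln χ_x(g⁻¹) - ln Tr(g* ρ g))`,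
with values in `(-∞, ∞]`. -/
def rate {d : ℕ} (ρ x : Mat d) : EReal :=
  ⨆ g : GL (Fin d) ℂ,
    ((- Real.log (chi x (↑g⁻¹ : Mat d))
      - Real.log ((Matrix.trace (star (↑g : Mat d) * ρ * (↑g : Mat d))).re) : ℝ) : EReal)

/-- Every Hermitian matrix has an ordered diagonalization. -/
theorem exists_isOrderedDiagonalization {d : ℕ} {x : Mat d} (hx : x.IsHermitian) :
    ∃ p : Mat d × (Fin d → ℝ), IsOrderedDiagonalization x p.1 p.2 := by
  let σ : Equiv.Perm (Fin d) := Tuple.sort (fun i => - hx.eigenvalues i)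
  have hσ : Monotone ((fun i => - hx.eigenvalues i) ∘ σ) := Tuple.monotone_sort _
  let u : Mat d := hx.eigenvectorUnitary
  have hu : star u * u = 1 := (Matrix.mem_unitaryGroup_iff').1 hx.eigenvectorUnitary.2
  have hspec : x = u * Matrix.diagonal (fun i => (hx.eigenvalues i : ℂ)) * star u := by
    have := hx.spectral_theorem
    rw [Unitary.conjStarAlgAut_apply] at this
    exact this
  refine ⟨(u.submatrix id σ, hx.eigenvalues ∘ σ), ?_, ?_, ?_⟩
  · rw [Matrix.mem_unitaryGroup_iff', star_eq_conjTranspose, conjTranspose_submatrix,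
      submatrix_mul _ _ _ id _ Function.bijective_id |>.symm, ← star_eq_conjTranspose, hu,
      submatrix_one_equiv]
  · intro i j hij
    have := hσ hij
    simpa using this
  · have hdiag : Matrix.diagonal (fun i => (((hx.eigenvalues ∘ σ) i : ℝ) : ℂ)) =
        (Matrix.diagonal (fun i => (hx.eigenvalues i : ℂ))).submatrix σ σ := by
      rw [submatrix_diagonal_equiv]; rfl
    simp only [hdiag, star_eq_conjTranspose, conjTranspose_submatrix]
    rw [submatrix_mul_equiv, submatrix_mul_equiv, submatrix_id_id, ← star_eq_conjTranspose]
    exact hspec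

/-- The ordered diagonalization chosen by `specPair` is a diagonalization. -/
theorem isOrderedDiagonalization_specPair {d : ℕ} {x : Mat d} (hx : x.IsHermitian) :
    IsOrderedDiagonalization x (specPair x).1 (specPair x).2 := by
  have h := exists_isOrderedDiagonalization hx
  rw [specPair, dif_pos h]
  exact h.choose_spec

/-- A unitary upper triangular matrix with nonnegative diagonal entries has unit diagonal. -/
theorem diag_eq_one_of_unitary_of_blockTriangular {d : ℕ} {u : Mat d}
    (hu : u ∈ Matrix.unitaryGroup (Fin d) ℂ) (ht : u.BlockTriangular (id : Fin d → Fin d))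
    (i : Fin d) (hi : 0 ≤ u i i) : u i i = 1 := by
  have h1 : u * star u = 1 := Matrix.mem_unitaryGroup_iff.1 hu
  have hinv : u⁻¹ = star u := Matrix.inv_eq_right_inv h1
  have : Invertible u := ⟨star u, mul_eq_one_comm.1 h1, h1⟩
  have ht' : (star u).BlockTriangular (id : Fin d → Fin d) :=
    hinv ▸ Matrix.blockTriangular_inv_of_blockTriangular ht
  have hoff : ∀ j, j ≠ i → u i j = 0 := by
    intro j hj
    rcases lt_or_gt_of_ne hj with h | h
    · exact ht h
    · have := ht' (i := j) (j := i) h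
      simpa [star_apply] using this
  have h2 := congrFun (congrFun h1 i) i
  rw [mul_apply, Finset.sum_eq_single i (fun j _ hj => by simp [hoff j hj]) (by simp),
    star_apply, one_apply_eq, (IsSelfAdjoint.of_nonneg hi).star_eq] at h2
  rcases mul_self_eq_one_iff.1 h2 with h | h
  · exact h
  · rw [h] at hi
    norm_num at hi

/-- The diagonal factor of the Iwasawa decomposition of `k * a`, for `k` unitary and `a` positive
diagonal, is `a`. -/
theorem iwaAlpha_mul_diagonal {d : ℕ} {k : Mat d} (hk : k ∈ Matrix.unitaryGroup (Fin d) ℂ)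
    {f : Fin d → ℝ} (hf : ∀ i, 0 < f i) :
    iwaAlpha (k * Matrix.diagonal (fun i => (f i : ℂ))) =
      Matrix.diagonal (fun i => Real.log (f i)) := by
  have h : ∃ t : Mat d × Mat d × Mat d,
      IsIwasawa (k * Matrix.diagonal (fun i => (f i : ℂ))) t.1 t.2.1 t.2.2 :=
    ⟨(k, Matrix.diagonal (fun i => (f i : ℂ)), 1), by simp, hk, ⟨f, hf, rfl⟩,
      blockTriangular_one, fun i => one_apply_eq i⟩
  rw [iwaAlpha, iwaTriple, dif_pos h]
  obtain ⟨heq, hk', ⟨f', hf', ha'⟩, hn, hn1⟩ := h.choose_spec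
  generalize h.choose = t at *
  obtain ⟨k', a', n⟩ := t
  dsimp only at *
  subst ha'
  congr 1
  ext i
  suffices hi : f' i = f i by simp [hi]
  let D : Mat d := Matrix.diagonal (fun i => (f i : ℂ))
  let E : Mat d := Matrix.diagonal (fun i => ((f i : ℂ))⁻¹)
  let D' : Mat d := Matrix.diagonal (fun i => (f' i : ℂ))
  have hDE : D * E = 1 := by
    simp only [D, E, diagonal_mul_diagonal, ← diagonal_one]
    congr 1
    ext j
    exact mul_inv_cancel₀ (by exact_mod_cast (hf j).ne')
  have hU : D' * n * E = star k' * k := by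
    have hk1 : star k' * k' = 1 := Matrix.mem_unitaryGroup_iff'.1 hk'
    calc D' * n * E = (star k' * k') * (D' * n * E) := by rw [hk1, one_mul]
      _ = star k' * (k' * D' * n) * E := by simp only [mul_assoc]
      _ = star k' * (k * D) * E := by rw [← heq]
      _ = star k' * k * (D * E) := by simp only [mul_assoc]
      _ = star k' * k := by rw [hDE, mul_one]
  have hent : (D' * n * E) i i = ((f' i / f i : ℝ) : ℂ) := by
    simp [D', E, mul_diagonal, diagonal_mul, hn1, div_eq_mul_inv]
  have h1 := diag_eq_one_of_unitary_of_blockTriangular (u := D' * n * E)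
    (hU ▸ mul_mem (Unitary.star_mem hk') hk)
    (((blockTriangular_diagonal _).mul hn).mul (blockTriangular_diagonal _)) i
    (by rw [hent]; exact_mod_cast (div_pos (hf' i) (hf i)).le)
  rw [hent] at h1
  have h2 : f' i / f i = 1 := by exact_mod_cast h1
  exact (div_eq_one_iff_eq (hf i).ne').1 h2

/-- Lower bound on the rate function obtained from `g = h * diagonal (exp t) * h*`, where
`x = h * diagonal f * h*` is the chosen spectral decomposition. -/
theorem le_rate {d : ℕ} (ρ : Mat d) {x : Mat d} (hx : x.IsHermitian) (t : Fin d → ℝ) :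
    ((2 * ∑ i, (specPair x).2 i * t i - Real.log (∑ i, Real.exp (2 * t i) *
      ((star (specPair x).1 * ρ * (specPair x).1) i i).re) : ℝ) : EReal) ≤ rate ρ x := by
  obtain ⟨hh, -, -⟩ := isOrderedDiagonalization_specPair hx
  set h := (specPair x).1 with h_def
  set f := (specPair x).2 with f_def
  have h1 : star h * h = 1 := Matrix.mem_unitaryGroup_iff'.1 hh
  have h2 : h * star h = 1 := Matrix.mem_unitaryGroup_iff.1 hh
  let D : (Fin d → ℝ) → Mat d := fun s => Matrix.diagonal (fun i => (Real.exp (s i) : ℂ))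
  have hD : ∀ s s', D s * D s' = D (s + s') := fun s s' => by
    simp [D, Complex.exp_add]
  have hD0 : D 0 = 1 := by simp [D]
  have hDs : ∀ s, star (D s) = D s := fun s => by
    simp only [D, star_eq_conjTranspose, diagonal_conjTranspose]
    congr 1
    ext i
    exact Complex.conj_ofReal _
  have hprod : ∀ s, (h * D s * star h) * (h * D (-s) * star h) = 1 := fun s => by
    calc _ = h * D s * (star h * h) * D (-s) * star h := by simp only [mul_assoc]
      _ = h * (D s * D (-s)) * star h := by rw [h1, mul_one, mul_assoc h]
      _ = 1 := by rw [hD, add_neg_cancel, hD0, mul_one, h2]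
  let g : GL (Fin d) ℂ :=
    ⟨h * D t * star h, h * D (-t) * star h, hprod t, by simpa using hprod (-t)⟩
  have hchi : Real.log (chi x (↑g⁻¹ : Mat d)) = - (2 * ∑ i, f i * t i) := by
    have e : (↑g⁻¹ : Mat d) * h = h * D (-t) := by
      change h * D (-t) * star h * h = _
      rw [mul_assoc, h1, mul_one]
    rw [chi, Real.log_exp, ← h_def, ← f_def, e, iwaAlpha_mul_diagonal hh fun i => Real.exp_pos _,
      diagonal_mul_diagonal, trace_diagonal]
    simp
  have htr : (Matrix.trace (star (↑g : Mat d) * ρ * (↑g : Mat d))).re =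
      ∑ i, Real.exp (2 * t i) * ((star h * ρ * h) i i).re := by
    have e : Matrix.trace (star (↑g : Mat d) * ρ * (↑g : Mat d)) =
        Matrix.trace (D (t + t) * (star h * ρ * h)) := by
      change Matrix.trace (star (h * D t * star h) * ρ * (h * D t * star h)) = _
      rw [star_mul, star_mul, star_star, hDs]
      calc _ = Matrix.trace (h * (D t * star h * ρ * h * D t * star h)) := by
            simp only [mul_assoc]
        _ = Matrix.trace (D t * star h * ρ * h * D t * (star h * h)) := by
            rw [trace_mul_comm]; simp only [mul_assoc]
        _ = Matrix.trace (D t * (D t * (star h * ρ * h))) := by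
            rw [h1, mul_one, trace_mul_comm]; simp only [mul_assoc]
        _ = _ := by rw [← mul_assoc, hD]
    rw [e, trace, Complex.re_sum]
    refine Finset.sum_congr rfl fun i _ => ?_
    simp only [D, diag_apply, diagonal_mul, Complex.re_ofReal_mul, Pi.add_apply, two_mul]
  refine le_trans (le_of_eq ?_) (le_iSup _ g)
  rw [hchi, htr, neg_neg]

theorem stmt12 (d : ℕ) (hd : 1 ≤ d) (ρ : Mat d) (hρ : ρ.PosSemidef)
    (hρ1 : Matrix.trace ρ = 1) (x : Mat d) (hx : x.IsHermitian)
    (hnot : ¬(x.PosSemidef ∧ Matrix.trace x = 1)) :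
    rate ρ x = ⊤ := by
  obtain ⟨hh, -, hxd⟩ := isOrderedDiagonalization_specPair hx
  have hle := le_rate ρ hx
  set h := (specPair x).1
  set f := (specPair x).2
  have h1 : star h * h = 1 := Matrix.mem_unitaryGroup_iff'.1 hh
  have h2 : h * star h = 1 := Matrix.mem_unitaryGroup_iff.1 hh
  have hσ : (star h * ρ * h).PosSemidef := hρ.conjTranspose_mul_mul_same h
  have hσ0 : ∀ i, 0 ≤ ((star h * ρ * h) i i).re := fun i =>
    (Complex.le_def.1 (hσ.diag_nonneg (i := i))).1
  have hσ1 : ∑ i, ((star h * ρ * h) i i).re = 1 := by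
    have e : Matrix.trace (star h * ρ * h) = 1 := by
      rw [trace_mul_comm, ← mul_assoc, h2, one_mul, hρ1]
    simpa [trace, Complex.re_sum] using congrArg Complex.re e
  refine EReal.eq_top_iff_forall_lt _ |>.2 fun y => ?_
  by_cases hpos : ∀ i, 0 ≤ f i
  · have hxpos : x.PosSemidef := by
      rw [hxd]
      exact (PosSemidef.diagonal fun i => Complex.zero_le_real.2 (hpos i)).mul_mul_conjTranspose_same h
    have htr : ∑ i, f i ≠ 1 := fun hs => hnot ⟨hxpos, by
      rw [hxd, trace_mul_comm, ← mul_assoc, h1, one_mul, trace_diagonal]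
      exact_mod_cast hs⟩
    refine lt_of_lt_of_le ?_ (hle fun _ => (y + 1) / (2 * (∑ i, f i - 1)))
    rw [← Finset.mul_sum, ← Finset.sum_mul, hσ1, mul_one, Real.log_exp, EReal.coe_lt_coe_iff]
    have hne : ∑ i, f i - 1 ≠ 0 := sub_ne_zero.2 htr
    have e : 2 * ((∑ i, f i) * ((y + 1) / (2 * (∑ i, f i - 1)))) -
        2 * ((y + 1) / (2 * (∑ i, f i - 1))) = y + 1 := by
      field_simp
    linarith
  · obtain ⟨i, hi⟩ := not_forall.1 hpos
    have hi : f i < 0 := not_le.1 hi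
    let s : ℝ := (|y| + 1) / (2 * f i)
    have hs : s ≤ 0 := div_nonpos_of_nonneg_of_nonpos (by positivity) (by linarith)
    refine lt_of_lt_of_le ?_ (hle (Pi.single i s))
    rw [EReal.coe_lt_coe_iff]
    have e : 2 * ∑ j, f j * (Pi.single i s : Fin d → ℝ) j = |y| + 1 := by
      simp only [Pi.single_apply, mul_ite, mul_zero, Finset.sum_ite_eq', Finset.mem_univ, if_true]
      simp only [s]
      field_simp [hi.ne]
    have hlog : Real.log (∑ j, Real.exp (2 * (Pi.single i s : Fin d → ℝ) j) *
        ((star h * ρ * h) j j).re) ≤ 0 := by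
      refine Real.log_nonpos
        (Finset.sum_nonneg fun j _ => mul_nonneg (Real.exp_pos _).le (hσ0 j)) ?_
      refine hσ1 ▸ Finset.sum_le_sum fun j _ => mul_le_of_le_one_left (hσ0 j) ?_
      refine Real.exp_le_one_iff.2 ?_
      by_cases hj : j = i
      · rw [hj, Pi.single_eq_same]
        linarith
      · simp [hj]
    rw [e]
    linarith [le_abs_self y]

end
end

section
/- For every d×d density matrix ρ (positive semidefinite with trace 1), the rate function vanishes at ρ itself: I_ρ(ρ) = 0, i.e. sup over g ∈ GL(d,ℂ) of ( −ln χ_ρ(g⁻¹) − ln Tr(g* ρ g) ) = 0. -/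
open Matrix
open scoped ComplexOrder

noncomputable section
open scoped Classical

theorem Matrix.BlockTriangular.of_mul_eq_one {d : ℕ} {B T : Mat d}
    (hT : T.BlockTriangular (id : Fin d → Fin d)) (h : B * T = 1) :
    B.BlockTriangular (id : Fin d → Fin d) := by
  have hB : T⁻¹ = B := inv_eq_left_inv h
  let _ : Invertible T := invertibleOfLeftInverse T B h
  exact hB ▸ blockTriangular_inv_of_blockTriangular hT

theorem Matrix.BlockTriangular.diag_mul_apply {d : ℕ} {B T : Mat d}
    (hB : B.BlockTriangular (id : Fin d → Fin d))
    (hT : T.BlockTriangular (id : Fin d → Fin d)) (j : Fin d) :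
    (B * T) j j = B j j * T j j := by
  rw [mul_apply]
  refine Finset.sum_eq_single j (fun i _ hij => ?_) (by simp)
  rcases lt_or_gt_of_ne hij with h | h
  · rw [hB h, zero_mul]
  · rw [hT h, mul_zero]

/-- Every invertible matrix has an Iwasawa decomposition. -/
theorem exists_isIwasawa {d : ℕ} {g : Mat d} (hg : IsUnit g.det) :
    ∃ t : Mat d × Mat d × Mat d, IsIwasawa g t.1 t.2.1 t.2.2 := by
  let v : Fin d → EuclideanSpace ℂ (Fin d) := fun j => WithLp.toLp 2 (g.col j)
  have hv : LinearIndependent ℂ v :=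
    (linearIndependent_cols_of_det_ne_zero hg.ne_zero).map'
      (WithLp.linearEquiv 2 ℂ (Fin d → ℂ)).symm.toLinearMap
      (LinearEquiv.ker (WithLp.linearEquiv 2 ℂ (Fin d → ℂ)).symm)
  let w := InnerProductSpace.gramSchmidt ℂ v
  have hw (i) : w i ≠ 0 := InnerProductSpace.gramSchmidt_ne_zero i hv
  have hwpos (i) : 0 < ‖w i‖ := norm_pos_iff.mpr (hw i)
  have hwC (i) : (‖w i‖ : ℂ) ≠ 0 := by exact_mod_cast (hwpos i).ne'
  let b := InnerProductSpace.gramSchmidtOrthonormalBasis (𝕜 := ℂ) (by simp) v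
  have hb (i) : b i = (‖w i‖ : ℂ)⁻¹ • w i := by
    refine InnerProductSpace.gramSchmidtOrthonormalBasis_apply _ ?_
    simpa [InnerProductSpace.gramSchmidtNormed] using hw i
  have hdiag (i) : inner ℂ (b i) (v i) = (‖w i‖ : ℂ) := by
    have h1 : inner ℂ (w i) (v i) = (‖w i‖ : ℂ) ^ 2 := by
      have h2 := congrArg (inner ℂ (w i)) (InnerProductSpace.gramSchmidt_def'' ℂ v i)
      rw [h2, inner_add_right, inner_sum, Finset.sum_eq_zero, add_zero]
      · exact inner_self_eq_norm_sq_to_K (w i)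
      · intro j hj
        rw [inner_smul_right,
          InnerProductSpace.gramSchmidt_orthogonal ℂ v (Finset.mem_Iio.mp hj).ne', mul_zero]
    rw [hb, inner_smul_left, h1]
    simp only [map_inv₀, Complex.conj_ofReal]
    field_simp [hwC i]
  refine ⟨⟨of fun i j => b j i, diagonal fun i => (‖w i‖ : ℂ),
    of fun i j => (‖w i‖ : ℂ)⁻¹ * inner ℂ (b i) (v j)⟩, ?_, ?_, ⟨_, hwpos, rfl⟩, ?_, ?_⟩
  · ext i j
    rw [mul_assoc, mul_apply]
    have h := congrArg (fun x => x i) (b.sum_repr' (v j))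
    simp only [WithLp.ofLp_sum, Finset.sum_apply, WithLp.ofLp_smul, Pi.smul_apply,
      smul_eq_mul] at h
    rw [show g i j = v j i from rfl, ← h]
    refine Finset.sum_congr rfl fun x _ => ?_
    rw [diagonal_mul]
    simp only [of_apply]
    rw [mul_inv_cancel_left₀ (hwC x), mul_comm]
  · exact (EuclideanSpace.basisFun (Fin d) ℂ).toMatrix_orthonormalBasis_mem_unitary b
  · intro i j hij
    have := InnerProductSpace.gramSchmidtOrthonormalBasis_inv_triangular
      (𝕜 := ℂ) (by simp) v (i := j) (j := i) hij
    simp only [of_apply]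
    rw [this, mul_zero]
  · intro i
    simp only [of_apply]
    rw [hdiag, inv_mul_cancel₀ (hwC i)]

/-- An invertible `g` is a unitary matrix times an upper triangular matrix with positive diagonal,
the logarithm of which is `iwaAlpha g`. -/
theorem exists_iwaAlpha_eq {d : ℕ} {g : Mat d} (hg : IsUnit g.det) :
    ∃ (k t : Mat d) (f : Fin d → ℝ), k ∈ unitaryGroup (Fin d) ℂ ∧ g = k * t ∧
      t.BlockTriangular (id : Fin d → Fin d) ∧ (∀ i, t i i = f i) ∧ (∀ i, 0 < f i) ∧
      iwaAlpha g = diagonal fun i => Real.log (f i) := by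
  have h := exists_isIwasawa hg
  have hI : IsIwasawa g (iwaTriple g).1 (iwaTriple g).2.1 (iwaTriple g).2.2 := by
    rw [iwaTriple, dif_pos h]
    exact h.choose_spec
  obtain ⟨hgk, hk, ⟨f, hf, ha⟩, hn, hn1⟩ := hI
  refine ⟨_, (iwaTriple g).2.1 * (iwaTriple g).2.2, f, hk, by rw [← mul_assoc, ← hgk], ?_, ?_, hf,
    ?_⟩
  · rw [ha]
    exact (blockTriangular_diagonal _).mul hn
  · intro i
    rw [ha, diagonal_mul, hn1, mul_one]
  · simp [iwaAlpha, ha]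

theorem iwaAlpha_eq_zero_of_mem_unitaryGroup {d : ℕ} {h : Mat d}
    (hh : h ∈ unitaryGroup (Fin d) ℂ) : iwaAlpha h = 0 := by
  obtain ⟨k, t, f, hk, hkt, ht, htf, hf, hα⟩ :=
    exists_iwaAlpha_eq (isUnit_det_of_left_inverse (mem_unitaryGroup_iff'.mp hh))
  have htu : star t * t = 1 := by
    have : t = star k * h := by
      rw [hkt, ← mul_assoc, mem_unitaryGroup_iff'.mp hk, one_mul]
    rw [this, star_mul, star_star, mul_assoc, ← mul_assoc k, mem_unitaryGroup_iff.mp hk, one_mul,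
      mem_unitaryGroup_iff'.mp hh]
  have hf1 (i) : f i = 1 := by
    have h1 := (ht.of_mul_eq_one htu).diag_mul_apply ht i
    rw [htu, one_apply_eq, star_apply, htf, Complex.star_def, Complex.conj_ofReal] at h1
    norm_cast at h1
    nlinarith [hf i]
  simp [hα, hf1]

theorem log_chi {d : ℕ} (x g : Mat d) :
    Real.log (chi x g) =
      2 * trace (diagonal (specPair x).2 * iwaAlpha (g * (specPair x).1)) :=
  Real.log_exp _

theorem trace_conj_diagonal_re {d : ℕ} (B : Mat d) (l : Fin d → ℝ) :
    (trace (star B * diagonal (fun i => (l i : ℂ)) * B)).re =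
      ∑ j, ∑ i, l i * Complex.normSq (B i j) := by
  simp only [trace, diag, mul_assoc, Complex.re_sum]
  refine Finset.sum_congr rfl fun j _ => ?_
  rw [mul_apply, Complex.re_sum]
  refine Finset.sum_congr rfl fun i _ => ?_
  rw [diagonal_mul, star_apply, Complex.star_def, mul_left_comm, ← Complex.normSq_eq_conj_mul_self,
    ← Complex.ofReal_mul, Complex.ofReal_re]

/-- The key inequality: every term of the supremum defining `rate ρ ρ` is nonpositive. -/
theorem neg_log_chi_inv_le_log_trace {d : ℕ} {ρ : Mat d} (hρ : ρ.PosSemidef)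
    (hρ1 : trace ρ = 1) (g : GL (Fin d) ℂ) :
    -Real.log (chi ρ (↑g⁻¹ : Mat d)) ≤
      Real.log (trace (star (↑g : Mat d) * ρ * (↑g : Mat d))).re := by
  obtain ⟨hh, -, hspec⟩ := isOrderedDiagonalization_specPair hρ.isHermitian
  rw [log_chi]
  set h := (specPair ρ).1
  set l := (specPair ρ).2
  have hhl := mem_unitaryGroup_iff'.mp hh
  have hhr := mem_unitaryGroup_iff.mp hh
  have hΛ : star h * ρ * h = diagonal fun i => (l i : ℂ) := by
    rw [hspec, mul_assoc, mul_assoc, mul_assoc, hhl, mul_one, ← mul_assoc, hhl, one_mul]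
  have hl0 (i) : 0 ≤ l i := by
    have h1 := (hρ.conjTranspose_mul_mul_same h).diag_nonneg (i := i)
    rw [← star_eq_conjTranspose, hΛ, diagonal_apply_eq] at h1
    exact_mod_cast h1
  have hl1 : ∑ i, l i = 1 := by
    have h1 : trace (star h * ρ * h) = 1 := by
      rw [trace_mul_comm, ← mul_assoc, hhr, one_mul, hρ1]
    rw [hΛ, trace_diagonal] at h1
    exact_mod_cast h1
  have hgg : (g : Mat d) * (↑g⁻¹ : Mat d) = 1 := by
    rw [← Units.val_mul, mul_inv_cancel, Units.val_one]
  obtain ⟨k, t, f, hk, hkt, ht, htf, hf, hα⟩ := exists_iwaAlpha_eq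
    (g := (↑g⁻¹ : Mat d) * h) (isUnit_det_of_left_inverse (B := star h * (g : Mat d)) (by
      rw [mul_assoc, ← mul_assoc (g : Mat d), hgg, one_mul, hhl]))
  have hkr := mem_unitaryGroup_iff.mp hk
  let B : Mat d := star h * g * k
  have hBt : B * t = 1 := by
    rw [mul_assoc, ← hkt, mul_assoc, ← mul_assoc (g : Mat d), hgg, one_mul, hhl]
  have hBf (j) : B j j = ((f j)⁻¹ : ℝ) := by
    have h1 := (ht.of_mul_eq_one hBt).diag_mul_apply ht j
    rw [hBt, one_apply_eq, htf] at h1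
    rw [Complex.ofReal_inv]
    exact eq_inv_of_mul_eq_one_left h1.symm
  have htr : trace (star (↑g : Mat d) * ρ * (↑g : Mat d)) =
      trace (star B * diagonal (fun i => (l i : ℂ)) * B) := by
    have h1 : star B * diagonal (fun i => (l i : ℂ)) * B =
        star k * (star (↑g : Mat d) * ρ * (↑g : Mat d) * k) := by
      rw [hspec]
      simp only [B, star_mul, star_star, mul_assoc]
    rw [h1, trace_mul_comm (star k), mul_assoc _ k, hkr, mul_one]
  have hlow : ∑ j, l j * ((f j)⁻¹ ^ 2) ≤ (trace (star (↑g : Mat d) * ρ * (↑g : Mat d))).re := by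
    rw [htr, trace_conj_diagonal_re]
    refine Finset.sum_le_sum fun j _ => ?_
    have h1 := Finset.single_le_sum (f := fun i => l i * Complex.normSq (B i j))
      (fun i _ => mul_nonneg (hl0 i) (Complex.normSq_nonneg _)) (Finset.mem_univ j)
    simpa only [hBf, Complex.normSq_ofReal, ← sq] using h1
  have hmem (j) : (f j)⁻¹ ^ 2 ∈ Set.Ioi (0 : ℝ) := pow_pos (inv_pos.mpr (hf j)) 2
  have hpos : 0 < ∑ j, l j * ((f j)⁻¹ ^ 2) :=
    (convex_Ioi (0 : ℝ)).sum_mem (fun i _ => hl0 i) hl1 fun j _ => hmem j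
  have hJ := strictConcaveOn_log_Ioi.concaveOn.le_map_sum (t := Finset.univ)
    (fun i _ => hl0 i) hl1 fun j _ => hmem j
  simp only [smul_eq_mul] at hJ
  refine le_trans (le_of_eq ?_) (hJ.trans (Real.log_le_log hpos hlow))
  rw [hα, diagonal_mul_diagonal, trace_diagonal, Finset.mul_sum, ← Finset.sum_neg_distrib]
  refine Finset.sum_congr rfl fun j _ => ?_
  rw [Real.log_pow, Real.log_inv]
  push_cast
  ring

theorem stmt15 (d : ℕ) (hd : 1 ≤ d) (ρ : Mat d) (hρ : ρ.PosSemidef)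
    (hρ1 : Matrix.trace ρ = 1) :
    rate ρ ρ = 0 := by
  refine le_antisymm (iSup_le fun g => ?_) ((le_of_eq ?_).trans (le_iSup _ 1))
  · exact_mod_cast sub_nonpos.mpr (neg_log_chi_inv_le_log_trace hρ hρ1 g)
  · have h := iwaAlpha_eq_zero_of_mem_unitaryGroup
      (isOrderedDiagonalization_specPair hρ.isHermitian).1
    simp [log_chi, h, hρ1]

end
end

section
/- Let ρ be a positive definite d×d density matrix (positive definite, trace 1), h a unitary matrix, and x₀ a real diagonal matrix with nonincreasing diagonal entries x₀,₁ ≥ … ≥ x₀,d. If all x₀,ᵢ ≥ 0 and Σᵢ x₀,ᵢ = 1, then I_ρ(h x₀ h*) = Σ_{i=1}^d [ x₀,ᵢ ln x₀,ᵢ − x₀,ᵢ ln( Δᵢ(h* ρ h) / Δᵢ₋₁(h* ρ h) ) ] (with the convention 0·ln 0 = 0); otherwise I_ρ(h x₀ h*) = ∞. -/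
open Matrix
open scoped ComplexOrder

noncomputable section
open scoped Classical

/-- The `i`-th leading principal minor of `σ`: the determinant of the upper-left `i × i`
submatrix, with `Δ₀(σ) = 1`. -/
def leadingMinor {d : ℕ} (σ : Mat d) (i : ℕ) (hi : i ≤ d) : ℂ :=
  Matrix.det (Matrix.of fun a b : Fin i => σ (Fin.castLE hi a) (Fin.castLE hi b))

theorem IsUnitUpperTriangular.det_eq_one {d : ℕ} {n : Mat d} (hn : IsUnitUpperTriangular n) :
    n.det = 1 := by
  rw [Matrix.det_of_isUpperTriangular hn.1]
  simp [hn.2]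

theorem upperTriangular_mul_apply_diag {d : ℕ} {m n : Mat d}
    (hm : m.BlockTriangular (id : Fin d → Fin d)) (hn : n.BlockTriangular (id : Fin d → Fin d))
    (i : Fin d) : (m * n) i i = m i i * n i i := by
  rw [Matrix.mul_apply]
  refine Finset.sum_eq_single i (fun k _ hk => ?_) (by simp)
  rcases lt_or_gt_of_ne hk with h | h
  · rw [hm h, zero_mul]
  · rw [hn h, mul_zero]

theorem IsUnitUpperTriangular.mul {d : ℕ} {m n : Mat d} (hm : IsUnitUpperTriangular m)
    (hn : IsUnitUpperTriangular n) : IsUnitUpperTriangular (m * n) :=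
  ⟨hm.1.mul hn.1, fun i => by
    rw [upperTriangular_mul_apply_diag hm.1 hn.1, hm.2, hn.2, one_mul]⟩

theorem IsUnitUpperTriangular.inv {d : ℕ} {n : Mat d} (hn : IsUnitUpperTriangular n) :
    IsUnitUpperTriangular n⁻¹ := by
  have hdet : IsUnit n.det := by simp [hn.det_eq_one]
  have : Invertible n := Matrix.invertibleOfIsUnitDet n hdet
  have htri := Matrix.blockTriangular_inv_of_blockTriangular hn.1
  refine ⟨htri, fun i => ?_⟩
  have := upperTriangular_mul_apply_diag htri hn.1 i
  rw [Matrix.nonsing_inv_mul _ hdet, hn.2, Matrix.one_apply_eq, mul_one] at this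
  exact this.symm

/-- The `LDL` decomposition with a unit triangular factor. -/
theorem exists_unitUpperTriangular_conj_diagonal {d : ℕ} {σ : Mat d} (hσ : σ.PosDef) :
    ∃ (U : Mat d) (D : Fin d → ℝ), IsUnitUpperTriangular U ∧ (∀ i, 0 < D i) ∧
      σ = Uᴴ * Matrix.diagonal (fun i => (D i : ℂ)) * U := by
  set N : Mat d := (LDL.lowerInv hσ)ᴴ with hN
  have hNtri : N.BlockTriangular (id : Fin d → Fin d) := by
    intro i j hij
    rw [hN, Matrix.conjTranspose_apply, LDL.lowerInv_triangular hσ (show j < i from hij), star_zero]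
  have hNdet : IsUnit N.det := by
    rw [hN, Matrix.det_conjTranspose]
    exact (Matrix.isUnit_det_of_invertible (LDL.lowerInv hσ)).star
  have hNdiag : ∀ i, N i i ≠ 0 := by
    rw [Matrix.det_of_isUpperTriangular hNtri, isUnit_iff_ne_zero, Finset.prod_ne_zero_iff] at hNdet
    exact fun i => hNdet i (Finset.mem_univ i)
  set M : Mat d := N * Matrix.diagonal (fun i => (N i i)⁻¹) with hM
  have hMu : IsUnitUpperTriangular M := by
    refine ⟨hNtri.mul (Matrix.blockTriangular_diagonal _), fun i => ?_⟩
    rw [hM, Matrix.mul_diagonal, mul_inv_cancel₀ (hNdiag i)]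
  have hMdet : IsUnit M.det := by simp [hMu.det_eq_one]
  have hpos : (Mᴴ * σ * M).PosDef :=
    hσ.conjTranspose_mul_mul_same
      (Matrix.mulVec_injective_of_isUnit ((Matrix.isUnit_iff_isUnit_det M).2 hMdet))
  have hdiag : Nᴴ * σ * N = LDL.diag hσ := by
    rw [LDL.diag_eq_lowerInv_conj, hN, Matrix.conjTranspose_conjTranspose]
  have hentry : ∀ i j, i ≠ j → (Mᴴ * σ * M) i j = 0 := by
    intro i j hij
    have : Mᴴ * σ * M = (Matrix.diagonal (fun i => (N i i)⁻¹))ᴴ * LDL.diag hσ *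
        Matrix.diagonal (fun i => (N i i)⁻¹) := by
      rw [← hdiag, hM, Matrix.conjTranspose_mul]
      simp only [Matrix.mul_assoc]
    rw [this, LDL.diag, Matrix.diagonal_conjTranspose, Matrix.diagonal_mul_diagonal,
      Matrix.diagonal_mul_diagonal, Matrix.diagonal_apply_ne _ hij]
  refine ⟨M⁻¹, fun i => ((Mᴴ * σ * M) i i).re, hMu.inv, fun i => ?_, ?_⟩
  · exact (Complex.pos_iff.1 (hpos.diag_pos (i := i))).1
  · have hD : Matrix.diagonal (fun i => ((((Mᴴ * σ * M) i i).re : ℝ) : ℂ)) = Mᴴ * σ * M := by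
      ext i j
      by_cases hij : i = j
      · subst hij
        rw [Matrix.diagonal_apply_eq]
        have := (Complex.pos_iff.1 (hpos.diag_pos (i := i))).2
        apply Complex.ext <;> simp [← this]
      · rw [Matrix.diagonal_apply_ne _ hij, hentry i j hij]
    have hMM : M * M⁻¹ = 1 := Matrix.mul_nonsing_inv _ hMdet
    have hMM' : M⁻¹ᴴ * Mᴴ = 1 := by
      rw [← Matrix.conjTranspose_mul, hMM, Matrix.conjTranspose_one]
    rw [hD]
    calc σ = (M⁻¹ᴴ * Mᴴ) * σ * (M * M⁻¹) := by rw [hMM, hMM', Matrix.one_mul, Matrix.mul_one]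
      _ = _ := by simp only [Matrix.mul_assoc]

theorem leadingMinor_conj {d : ℕ} (A M : Mat d) {i : ℕ} (hi : i ≤ d)
    (hM : ∀ k b : Fin d, (b : ℕ) < i → i ≤ (k : ℕ) → M k b = 0) :
    leadingMinor (Mᴴ * A * M) i hi
      = star (leadingMinor M i hi) * leadingMinor A i hi * leadingMinor M i hi := by
  have hsum : ∀ F : Fin d → ℂ, (∀ k : Fin d, i ≤ (k : ℕ) → F k = 0) →
      ∑ k, F k = ∑ k : Fin i, F (Fin.castLE hi k) := by
    intro F hF
    symm
    refine Finset.sum_of_injOn (Fin.castLE hi) ((Fin.castLE_injective hi).injOn) (by simp) ?_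
      (by simp)
    intro k _ hk
    apply hF
    by_contra! hlt
    exact hk ⟨⟨k, hlt⟩, by simp, by ext; simp⟩
  unfold leadingMinor
  rw [← Matrix.det_conjTranspose, ← Matrix.det_mul, ← Matrix.det_mul]
  congr 1
  ext a b
  simp only [Matrix.of_apply, Matrix.mul_apply, Matrix.conjTranspose_apply]
  rw [hsum _ (fun k hk => by rw [hM k _ b.isLt hk, mul_zero])]
  refine Finset.sum_congr rfl fun k _ => ?_
  rw [hsum _ (fun l hl => by rw [hM l _ a.isLt hl, star_zero, zero_mul])]

theorem leadingMinor_diagonal {d : ℕ} (D : Fin d → ℂ) {i : ℕ} (hi : i ≤ d) :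
    leadingMinor (Matrix.diagonal D) i hi = ∏ j : Fin i, D (Fin.castLE hi j) := by
  rw [leadingMinor, ← Matrix.det_diagonal]
  congr 1
  ext a b
  simp [Matrix.diagonal_apply]

theorem IsUnitUpperTriangular.leadingMinor_eq_one {d : ℕ} {n : Mat d}
    (hn : IsUnitUpperTriangular n) {i : ℕ} (hi : i ≤ d) : leadingMinor n i hi = 1 := by
  rw [leadingMinor, Matrix.det_of_isUpperTriangular]
  · simp [hn.2]
  · intro a b hab
    exact hn.1 (by simpa using hab)

theorem leadingMinor_unitUpperTriangular_conj {d : ℕ} {U : Mat d} (hU : IsUnitUpperTriangular U)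
    (D : Fin d → ℝ) {i : ℕ} (hi : i ≤ d) :
    leadingMinor (Uᴴ * Matrix.diagonal (fun i => (D i : ℂ)) * U) i hi
      = ((∏ j : Fin i, D (Fin.castLE hi j) : ℝ) : ℂ) := by
  rw [leadingMinor_conj _ _ hi, hU.leadingMinor_eq_one hi, leadingMinor_diagonal]
  · simp
  · intro k b hb hk
    exact hU.1 (show b < k from Fin.lt_def.2 (by omega))

theorem leadingMinor_ratio {d : ℕ} {σ U : Mat d} (hU : IsUnitUpperTriangular U)
    {D : Fin d → ℝ} (hD : ∀ i, 0 < D i)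
    (hσ : σ = Uᴴ * Matrix.diagonal (fun i => (D i : ℂ)) * U) (i : Fin d) :
    (leadingMinor σ (i + 1) i.isLt).re / (leadingMinor σ i (le_of_lt i.isLt)).re = D i := by
  rw [hσ, leadingMinor_unitUpperTriangular_conj hU, leadingMinor_unitUpperTriangular_conj hU,
    Complex.ofReal_re, Complex.ofReal_re, Fin.prod_univ_castSucc]
  have hne : (∏ j : Fin i, D (Fin.castLE (le_of_lt i.isLt) j)) ≠ 0 :=
    (Finset.prod_pos fun j _ => hD _).ne'
  exact mul_div_cancel_left₀ _ hne

theorem leadingMinor_re_pos {d : ℕ} {σ : Mat d} (hσ : σ.PosDef) {i : ℕ} (hi : i ≤ d) :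
    0 < (leadingMinor σ i hi).re := by
  obtain ⟨U, D, hU, hD, rfl⟩ := exists_unitUpperTriangular_conj_diagonal hσ
  rw [leadingMinor_unitUpperTriangular_conj hU, Complex.ofReal_re]
  exact Finset.prod_pos fun j _ => hD _

theorem eq_of_unitUpperTriangular_conj_diagonal {d : ℕ} {U V : Mat d} {D E : Fin d → ℝ}
    (hU : IsUnitUpperTriangular U) (hV : IsUnitUpperTriangular V)
    (hD : ∀ i, 0 < D i) (hE : ∀ i, 0 < E i)
    (h : Uᴴ * Matrix.diagonal (fun i => (D i : ℂ)) * U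
      = Vᴴ * Matrix.diagonal (fun i => (E i : ℂ)) * V) : D = E := by
  funext i
  rw [← leadingMinor_ratio hV hE h i, leadingMinor_ratio hU hD rfl i]

theorem leadingMinor_one {d : ℕ} {i : ℕ} (hi : i ≤ d) : leadingMinor (1 : Mat d) i hi = 1 := by
  rw [← Matrix.diagonal_one, leadingMinor_diagonal]
  simp

theorem leadingMinor_unitary_conj {d : ℕ} (A : Mat d) {u : Mat d} (hu : uᴴ * u = 1) {i : ℕ}
    (hi : i ≤ d) (hM : ∀ k b : Fin d, (b : ℕ) < i → i ≤ (k : ℕ) → u k b = 0) :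
    leadingMinor (uᴴ * A * u) i hi = leadingMinor A i hi := by
  have h1 := leadingMinor_conj 1 u hi hM
  rw [Matrix.mul_one, hu, leadingMinor_one, mul_one] at h1
  rw [leadingMinor_conj A u hi hM, mul_right_comm, ← h1, one_mul]

theorem IsIwasawa.conjTranspose_mul_self {d : ℕ} {g k n : Mat d} {α : Fin d → ℝ}
    (h : IsIwasawa g k (Matrix.diagonal fun i => (α i : ℂ)) n) :
    gᴴ * g = nᴴ * Matrix.diagonal (fun i => ((α i ^ 2 : ℝ) : ℂ)) * n := by
  have hk : kᴴ * k = 1 := Matrix.mem_unitaryGroup_iff'.1 h.2.1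
  have hα : Matrix.diagonal (fun i => ((α i ^ 2 : ℝ) : ℂ))
      = (Matrix.diagonal fun i => (α i : ℂ))ᴴ * (kᴴ * k) * Matrix.diagonal fun i => (α i : ℂ) := by
    rw [hk, Matrix.mul_one, Matrix.diagonal_conjTranspose, Matrix.diagonal_mul_diagonal]
    congr 1
    funext i
    simp [sq]
  rw [hα, h.1]
  simp only [Matrix.conjTranspose_mul, Matrix.mul_assoc]

theorem iwaAlpha_eq {d : ℕ} {g k n : Mat d} {α : Fin d → ℝ} (hα : ∀ i, 0 < α i)
    (h : IsIwasawa g k (Matrix.diagonal fun i => (α i : ℂ)) n) :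
    iwaAlpha g = Matrix.diagonal fun i => Real.log (α i) := by
  have hex : ∃ t : Mat d × Mat d × Mat d, IsIwasawa g t.1 t.2.1 t.2.2 := ⟨(k, _, n), h⟩
  have hspec : IsIwasawa g (iwaTriple g).1 (iwaTriple g).2.1 (iwaTriple g).2.2 := by
    rw [iwaTriple, dif_pos hex]
    exact hex.choose_spec
  obtain ⟨β, hβ, hβa⟩ := hspec.2.2.1
  rw [hβa] at hspec
  have hsq : (fun i => β i ^ 2) = fun i => α i ^ 2 :=
    eq_of_unitUpperTriangular_conj_diagonal hspec.2.2.2 h.2.2.2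
      (fun i => pow_pos (hβ i) 2) (fun i => pow_pos (hα i) 2)
      (hspec.conjTranspose_mul_self.symm.trans h.conjTranspose_mul_self)
  rw [iwaAlpha, hβa]
  congr 1
  funext i
  rw [Matrix.diagonal_apply_eq, Complex.ofReal_re,
    (pow_left_inj₀ (hβ i).le (hα i).le two_ne_zero).1 (congrFun hsq i)]

theorem exists_isIwasawa_s16 {d : ℕ} {g : Mat d} (hg : IsUnit g) :
    ∃ (k n : Mat d) (α : Fin d → ℝ), (∀ i, 0 < α i) ∧
      IsIwasawa g k (Matrix.diagonal fun i => (α i : ℂ)) n := by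
  have hpos : (gᴴ * g).PosDef := by
    simpa using (Matrix.PosDef.one (n := Fin d) (R := ℂ)).conjTranspose_mul_mul_same
      (Matrix.mulVec_injective_of_isUnit hg)
  obtain ⟨U, D, hU, hD, hgU⟩ := exists_unitUpperTriangular_conj_diagonal hpos
  have hUdet : IsUnit U.det := by simp [hU.det_eq_one]
  have hUU : U * U⁻¹ = 1 := Matrix.mul_nonsing_inv _ hUdet
  have hUU' : U⁻¹ᴴ * Uᴴ = 1 := by
    rw [← Matrix.conjTranspose_mul, hUU, Matrix.conjTranspose_one]
  have hs : ∀ i, 0 < √(D i) := fun i => Real.sqrt_pos.2 (hD i)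
  have hsc : ∀ i, ((√(D i) : ℝ) : ℂ) ≠ 0 := fun i => by exact_mod_cast (hs i).ne'
  refine ⟨g * U⁻¹ * Matrix.diagonal (fun i => ((√(D i) : ℝ) : ℂ)⁻¹), U, fun i => √(D i), hs,
    ?_, ?_, ⟨_, hs, rfl⟩, hU⟩
  · rw [Matrix.mul_assoc (g * U⁻¹), Matrix.diagonal_mul_diagonal]
    simp only [inv_mul_cancel₀ (hsc _), Matrix.diagonal_one, Matrix.mul_one]
    rw [Matrix.mul_assoc, Matrix.nonsing_inv_mul _ hUdet, Matrix.mul_one]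
  · rw [Matrix.mem_unitaryGroup_iff', Matrix.star_eq_conjTranspose]
    calc _ = (Matrix.diagonal (fun i => ((√(D i) : ℝ) : ℂ)⁻¹))ᴴ * U⁻¹ᴴ * (gᴴ * g) * U⁻¹ *
              Matrix.diagonal (fun i => ((√(D i) : ℝ) : ℂ)⁻¹) := by
            simp only [Matrix.conjTranspose_mul, Matrix.mul_assoc]
      _ = (Matrix.diagonal (fun i => ((√(D i) : ℝ) : ℂ)⁻¹))ᴴ * (U⁻¹ᴴ * Uᴴ) *
            Matrix.diagonal (fun i => (D i : ℂ)) * (U * U⁻¹) *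
              Matrix.diagonal (fun i => ((√(D i) : ℝ) : ℂ)⁻¹) := by
            rw [hgU]
            simp only [Matrix.mul_assoc]
      _ = 1 := by
        rw [hUU, hUU', Matrix.mul_one, Matrix.mul_one, Matrix.diagonal_conjTranspose,
          Matrix.diagonal_mul_diagonal, Matrix.diagonal_mul_diagonal, ← Matrix.diagonal_one]
        congr 1
        funext i
        have hsq : (D i : ℂ) = ((√(D i) : ℝ) : ℂ) * ((√(D i) : ℝ) : ℂ) := by
          rw [← Complex.ofReal_mul, Real.mul_self_sqrt (hD i).le]
        have hstar : star (((√(D i) : ℝ) : ℂ)⁻¹) = ((√(D i) : ℝ) : ℂ)⁻¹ := by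
          rw [star_inv₀, Complex.star_def, Complex.conj_ofReal]
        rw [Pi.star_apply, hstar, hsq]
        field_simp [hsc i]

/-- The eigenvalue tuple of an ordered spectral decomposition is unique. -/
theorem IsOrderedDiagonalization.eigenvalues_unique {d : ℕ} {x h h' : Mat d} {f f' : Fin d → ℝ}
    (hx : IsOrderedDiagonalization x h f) (hx' : IsOrderedDiagonalization x h' f') : f = f' := by
  have key : ∀ (u : Mat d) (e : Fin d → ℝ), IsOrderedDiagonalization x u e →
      x.charpoly.roots = Multiset.map (fun i => (e i : ℂ)) Finset.univ.val := by
    intro u e hu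
    have hu' : star u * u = 1 := Matrix.mem_unitaryGroup_iff'.1 hu.1
    rw [hu.2.2, Matrix.charpoly_mul_comm, ← Matrix.mul_assoc, hu', Matrix.one_mul]
    rw [Matrix.charpoly_diagonal]
    have hr := Polynomial.roots_multiset_prod_X_sub_C
      (Multiset.map (fun i => (e i : ℂ)) Finset.univ.val)
    rwa [Multiset.map_map] at hr
  have hm := (key h f hx).symm.trans (key h' f' hx')
  have hm' : Multiset.map f Finset.univ.val = Multiset.map f' Finset.univ.val := by
    have := congrArg (Multiset.map Complex.re) hm
    simpa [Multiset.map_map, Function.comp_def] using this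
  have hperm : (List.ofFn f).Perm (List.ofFn f') := by
    rw [← Multiset.coe_eq_coe]
    simpa [Fin.univ_val_map] using hm'
  exact List.ofFn_injective
    (hperm.eq_of_pairwise' hx.2.1.sortedGE_ofFn.pairwise hx'.2.1.sortedGE_ofFn.pairwise)

theorem exists_specPair_eq {d : ℕ} {x h : Mat d} {f : Fin d → ℝ}
    (hx : IsOrderedDiagonalization x h f) :
    ∃ h' : Mat d, specPair x = (h', f) ∧ IsOrderedDiagonalization x h' f := by
  have hex : ∃ p : Mat d × (Fin d → ℝ), IsOrderedDiagonalization x p.1 p.2 := ⟨(h, f), hx⟩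
  have hspec : IsOrderedDiagonalization x (specPair x).1 (specPair x).2 := by
    rw [specPair, dif_pos hex]
    exact hex.choose_spec
  have hf := hx.eigenvalues_unique hspec
  refine ⟨(specPair x).1, ?_, ?_⟩
  · rw [hf]
  · rwa [hf]

theorem log_chi_s16 {d : ℕ} {x h g k n : Mat d} {f α : Fin d → ℝ} (hx : specPair x = (h, f))
    (hα : ∀ i, 0 < α i) (hg : IsIwasawa (g * h) k (Matrix.diagonal fun i => (α i : ℂ)) n) :
    Real.log (chi x g) = 2 * ∑ i, f i * Real.log (α i) := by
  rw [chi, hx, Real.log_exp, iwaAlpha_eq hα hg, Matrix.diagonal_mul_diagonal,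
    Matrix.trace_diagonal]

/-- Each term of the rate function is bounded by the reduced functional on diagonal data. -/
theorem exists_rate_term_le {d : ℕ} (hd : 1 ≤ d) {ρ x h U : Mat d} {f D : Fin d → ℝ}
    (hx : specPair x = (h, f)) (hh : h ∈ Matrix.unitaryGroup (Fin d) ℂ)
    (hU : IsUnitUpperTriangular U) (hD : ∀ i, 0 < D i)
    (hσ : hᴴ * ρ * h = Uᴴ * Matrix.diagonal (fun i => (D i : ℂ)) * U) (g : GL (Fin d) ℂ) :
    ∃ b : Fin d → ℝ, (∀ i, 0 < b i) ∧
      - Real.log (chi x (↑g⁻¹ : Mat d))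
        - Real.log ((Matrix.trace (star (↑g : Mat d) * ρ * (↑g : Mat d))).re)
      ≤ ∑ i, f i * Real.log (b i) - Real.log (∑ i, b i * D i) := by
  have : Nonempty (Fin d) := ⟨⟨0, hd⟩⟩
  have hhu : IsUnit h := (Matrix.isUnit_iff_isUnit_det h).2
    (Matrix.isUnit_det_of_left_inverse (Matrix.mem_unitaryGroup_iff'.1 hh))
  obtain ⟨k, n, α, hα, hI⟩ := exists_isIwasawa_s16 (g⁻¹.isUnit.mul hhu)
  have hkk : k * kᴴ = 1 := Matrix.mem_unitaryGroup_iff.1 hI.2.1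
  have hn := hI.2.2.2
  have hndet : IsUnit n.det := by simp [hn.det_eq_one]
  have hnn : n * n⁻¹ = 1 := Matrix.mul_nonsing_inv _ hndet
  have hαc : ∀ i, (α i : ℂ) ≠ 0 := fun i => by exact_mod_cast (hα i).ne'
  have hαα : (Matrix.diagonal fun i => (α i : ℂ)) * Matrix.diagonal (fun i => (α i : ℂ)⁻¹) = 1 := by
    rw [Matrix.diagonal_mul_diagonal]
    simp only [mul_inv_cancel₀ (hαc _), Matrix.diagonal_one]
  set A : Mat d := Matrix.diagonal (fun i => (α i : ℂ)⁻¹) with hA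
  set V : Mat d := U * n⁻¹ with hV
  have hVu : IsUnitUpperTriangular V := hU.mul hn.inv
  have hgk : (g : Mat d) * k = h * n⁻¹ * A := by
    have h1 : h = (g : Mat d) * (k * (Matrix.diagonal fun i => (α i : ℂ)) * n) := by
      rw [← hI.1, ← Matrix.mul_assoc, ← Units.val_mul, mul_inv_cancel, Units.val_one,
        Matrix.one_mul]
    calc (g : Mat d) * k = (g : Mat d) * k * ((Matrix.diagonal fun i => (α i : ℂ)) * (n * n⁻¹) * A)
          := by rw [hnn, Matrix.mul_one, hαα, Matrix.mul_one]
      _ = (g : Mat d) * (k * (Matrix.diagonal fun i => (α i : ℂ)) * n) * n⁻¹ * A := by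
          simp only [Matrix.mul_assoc]
      _ = _ := by rw [← h1]
  have htr : Matrix.trace (star (g : Mat d) * ρ * (g : Mat d))
      = Matrix.trace (Aᴴ * (Vᴴ * Matrix.diagonal (fun i => (D i : ℂ)) * V) * A) := by
    calc _ = Matrix.trace ((g : Mat d)ᴴ * ρ * (g : Mat d) * (k * kᴴ)) := by
          rw [hkk, Matrix.mul_one, Matrix.star_eq_conjTranspose]
      _ = Matrix.trace (((g : Mat d) * k)ᴴ * ρ * ((g : Mat d) * k)) := by
          rw [← Matrix.mul_assoc, Matrix.trace_mul_comm]
          simp only [Matrix.conjTranspose_mul, Matrix.mul_assoc]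
      _ = Matrix.trace (Aᴴ * (n⁻¹ᴴ * (hᴴ * ρ * h) * n⁻¹) * A) := by
          rw [hgk]
          simp only [Matrix.conjTranspose_mul, Matrix.mul_assoc]
      _ = _ := by
          rw [hσ, hV]
          simp only [Matrix.conjTranspose_mul, Matrix.mul_assoc]
  have hentry : ∀ i, (Aᴴ * (Vᴴ * Matrix.diagonal (fun i => (D i : ℂ)) * V) * A) i i
      = (((α i ^ 2)⁻¹ * ∑ j, D j * Complex.normSq (V j i) : ℝ) : ℂ) := by
    intro i
    have h2 : (Vᴴ * Matrix.diagonal (fun i => (D i : ℂ)) * V) i i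
        = ((∑ j, D j * Complex.normSq (V j i) : ℝ) : ℂ) := by
      rw [Matrix.mul_apply, Complex.ofReal_sum]
      refine Finset.sum_congr rfl fun j _ => ?_
      rw [Matrix.mul_diagonal, Matrix.conjTranspose_apply, Complex.ofReal_mul,
        Complex.normSq_eq_conj_mul_self, Complex.star_def]
      ring
    rw [hA, Matrix.mul_diagonal, Matrix.diagonal_conjTranspose, Matrix.diagonal_mul, h2,
      Pi.star_apply, Complex.star_def, ← Complex.ofReal_inv, Complex.conj_ofReal]
    push_cast
    ring
  have hb : ∀ i, 0 < (α i ^ 2)⁻¹ := fun i => inv_pos.2 (pow_pos (hα i) 2)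
  refine ⟨fun i => (α i ^ 2)⁻¹, hb, ?_⟩
  have hlog : - Real.log (chi x (↑g⁻¹ : Mat d)) = ∑ i, f i * Real.log ((α i ^ 2)⁻¹) := by
    rw [log_chi_s16 hx hα hI, Finset.mul_sum, ← Finset.sum_neg_distrib]
    refine Finset.sum_congr rfl fun i _ => ?_
    rw [Real.log_inv, Real.log_pow]
    push_cast
    ring
  rw [hlog, htr, Matrix.trace]
  simp only [Matrix.diag_apply, hentry]
  rw [← Complex.ofReal_sum, Complex.ofReal_re]
  refine sub_le_sub_left (Real.log_le_log
    (Finset.sum_pos (fun i _ => mul_pos (hb i) (hD i)) Finset.univ_nonempty)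
    (Finset.sum_le_sum fun i _ => mul_le_mul_of_nonneg_left ?_ (hb i).le)) _
  calc D i = D i * Complex.normSq (V i i) := by rw [hVu.2, map_one, mul_one]
    _ ≤ _ := Finset.single_le_sum (f := fun j => D j * Complex.normSq (V j i))
      (fun j _ => mul_nonneg (hD j).le (Complex.normSq_nonneg _)) (Finset.mem_univ i)

/-- Every value of the reduced functional is attained as a term of the rate function. -/
theorem exists_rate_term_eq {d : ℕ} {ρ x h U : Mat d} {f D : Fin d → ℝ}
    (hx : specPair x = (h, f)) (hh : h ∈ Matrix.unitaryGroup (Fin d) ℂ)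
    (hU : IsUnitUpperTriangular U)
    (hσ : hᴴ * ρ * h = Uᴴ * Matrix.diagonal (fun i => (D i : ℂ)) * U)
    {c : Fin d → ℝ} (hc : ∀ i, 0 < c i) :
    ∃ g : GL (Fin d) ℂ,
      - Real.log (chi x (↑g⁻¹ : Mat d))
        - Real.log ((Matrix.trace (star (↑g : Mat d) * ρ * (↑g : Mat d))).re)
      = 2 * ∑ i, f i * Real.log (c i) - Real.log (∑ i, c i ^ 2 * D i) := by
  have hhh : hᴴ * h = 1 := Matrix.mem_unitaryGroup_iff'.1 hh
  have hhh' : h * hᴴ = 1 := Matrix.mem_unitaryGroup_iff.1 hh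
  have hUdet : IsUnit U.det := by simp [hU.det_eq_one]
  have hUU : U * U⁻¹ = 1 := Matrix.mul_nonsing_inv _ hUdet
  have hUU' : U⁻¹ * U = 1 := Matrix.nonsing_inv_mul _ hUdet
  have hUUs : U⁻¹ᴴ * Uᴴ = 1 := by
    rw [← Matrix.conjTranspose_mul, hUU, Matrix.conjTranspose_one]
  have hcc : ∀ i, (c i : ℂ) ≠ 0 := fun i => by exact_mod_cast (hc i).ne'
  set C : Mat d := Matrix.diagonal (fun i => (c i : ℂ)) with hC
  set A : Mat d := Matrix.diagonal (fun i => (((c i)⁻¹ : ℝ) : ℂ)) with hA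
  have hCA : C * A = 1 := by
    rw [hC, hA, Matrix.diagonal_mul_diagonal]
    simp only [Complex.ofReal_inv, mul_inv_cancel₀ (hcc _), Matrix.diagonal_one]
  have hAC : A * C = 1 := by
    rw [hC, hA, Matrix.diagonal_mul_diagonal]
    simp only [Complex.ofReal_inv, inv_mul_cancel₀ (hcc _), Matrix.diagonal_one]
  let g : GL (Fin d) ℂ := ⟨h * U⁻¹ * C, A * U * hᴴ, by
    calc _ = h * (U⁻¹ * (C * A) * U) * hᴴ := by simp only [Matrix.mul_assoc]
      _ = 1 := by rw [hCA, Matrix.mul_one, hUU', Matrix.mul_one, hhh'], by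
    calc _ = A * (U * (hᴴ * h) * U⁻¹) * C := by simp only [Matrix.mul_assoc]
      _ = 1 := by rw [hhh, Matrix.mul_one, hUU, Matrix.mul_one, hAC]⟩
  have hI : IsIwasawa ((↑g⁻¹ : Mat d) * h) 1 A U := by
    refine ⟨?_, one_mem _, ⟨_, fun i => inv_pos.2 (hc i), rfl⟩, hU⟩
    change A * U * hᴴ * h = _
    rw [Matrix.mul_assoc, hhh, Matrix.mul_one, Matrix.one_mul]
  refine ⟨g, ?_⟩
  have htr : star (g : Mat d) * ρ * (g : Mat d)
      = Matrix.diagonal (fun i => ((c i ^ 2 * D i : ℝ) : ℂ)) := by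
    change (h * U⁻¹ * C)ᴴ * ρ * (h * U⁻¹ * C) = _
    calc _ = Cᴴ * (U⁻¹ᴴ * (hᴴ * ρ * h) * U⁻¹) * C := by
          simp only [Matrix.conjTranspose_mul, Matrix.mul_assoc]
      _ = Cᴴ * ((U⁻¹ᴴ * Uᴴ) * Matrix.diagonal (fun i => (D i : ℂ)) * (U * U⁻¹)) * C := by
          rw [hσ]
          simp only [Matrix.mul_assoc]
      _ = _ := by
          rw [hUUs, hUU, Matrix.one_mul, Matrix.mul_one, hC, Matrix.diagonal_conjTranspose,
            Matrix.diagonal_mul_diagonal, Matrix.diagonal_mul_diagonal]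
          congr 1
          funext i
          rw [Pi.star_apply, Complex.star_def, Complex.conj_ofReal]
          push_cast
          ring
  rw [log_chi_s16 hx (fun i => inv_pos.2 (hc i)) hI, htr, Matrix.trace_diagonal,
    ← Complex.ofReal_sum, Complex.ofReal_re]
  simp only [Real.log_inv, mul_neg, Finset.sum_neg_distrib, neg_neg]

theorem exists_rate_term_eq_log {d : ℕ} {ρ x h U : Mat d} {f D : Fin d → ℝ}
    (hx : specPair x = (h, f)) (hh : h ∈ Matrix.unitaryGroup (Fin d) ℂ)
    (hU : IsUnitUpperTriangular U) (hD : ∀ i, 0 < D i)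
    (hσ : hᴴ * ρ * h = Uᴴ * Matrix.diagonal (fun i => (D i : ℂ)) * U)
    {y : Fin d → ℝ} (hy : ∀ i, 0 < y i) :
    ∃ g : GL (Fin d) ℂ,
      - Real.log (chi x (↑g⁻¹ : Mat d))
        - Real.log ((Matrix.trace (star (↑g : Mat d) * ρ * (↑g : Mat d))).re)
      = ∑ i, f i * Real.log (y i) - ∑ i, f i * Real.log (D i) - Real.log (∑ i, y i) := by
  have hq : ∀ i, 0 < y i / D i := fun i => div_pos (hy i) (hD i)
  obtain ⟨g, hg⟩ := exists_rate_term_eq hx hh hU hσ (fun i => Real.sqrt_pos.2 (hq i))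
  refine ⟨g, hg.trans ?_⟩
  congr 1
  · rw [← Finset.sum_sub_distrib, Finset.mul_sum]
    refine Finset.sum_congr rfl fun i _ => ?_
    rw [Real.log_sqrt (hq i).le, Real.log_div (hy i).ne' (hD i).ne']
    ring
  · congr 1
    refine Finset.sum_congr rfl fun i _ => ?_
    rw [Real.sq_sqrt (hq i).le, div_mul_cancel₀ _ (ne_of_gt (hD i))]

/-- The Gibbs variational inequality. -/
theorem gibbs_inequality {ι : Type*} [Fintype ι] [Nonempty ι] {f b D : ι → ℝ}
    (hf : ∀ i, 0 ≤ f i) (hf1 : ∑ i, f i = 1) (hb : ∀ i, 0 < b i) (hD : ∀ i, 0 < D i) :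
    ∑ i, f i * Real.log (b i) - Real.log (∑ i, b i * D i)
      ≤ ∑ i, (f i * Real.log (f i) - f i * Real.log (D i)) := by
  set S := ∑ i, b i * D i with hS
  have hSpos : 0 < S :=
    Finset.sum_pos (fun i _ => mul_pos (hb i) (hD i)) Finset.univ_nonempty
  have hterm : ∀ i, f i * Real.log (b i) - f i * Real.log S
      - (f i * Real.log (f i) - f i * Real.log (D i)) ≤ b i * D i / S - f i := by
    intro i
    have hbD := mul_pos (hb i) (hD i)
    rcases (hf i).eq_or_lt with h0 | hpos
    · rw [← h0]
      simp only [zero_mul, sub_zero]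
      exact (div_pos hbD hSpos).le
    · have hlog := Real.log_le_sub_one_of_pos (div_pos hbD (mul_pos hSpos hpos))
      rw [Real.log_div hbD.ne' (mul_pos hSpos hpos).ne', Real.log_mul (hb i).ne' (hD i).ne',
        Real.log_mul hSpos.ne' hpos.ne'] at hlog
      have := mul_le_mul_of_nonneg_left hlog hpos.le
      have hcancel : f i * (b i * D i / (S * f i) - 1) = b i * D i / S - f i := by
        field_simp
      linarith
  have hsum := Finset.sum_le_sum fun i (_ : i ∈ Finset.univ) => hterm i
  simp only [Finset.sum_sub_distrib] at hsum ⊢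
  rw [← Finset.sum_mul, ← Finset.sum_div, hf1, ← hS, div_self hSpos.ne'] at hsum
  linarith

/-- Outside the probability simplex the functional `∑ fᵢ log yᵢ - log ∑ yᵢ` is unbounded. -/
theorem exists_lt_sum_mul_log_sub_log_sum {ι : Type*} [Fintype ι] [Nonempty ι] {f : ι → ℝ}
    (hf : ¬((∀ i, 0 ≤ f i) ∧ ∑ i, f i = 1)) (M : ℝ) :
    ∃ y : ι → ℝ, (∀ i, 0 < y i) ∧ M < ∑ i, f i * Real.log (y i) - Real.log (∑ i, y i) := by
  have hc : (0 : ℝ) < Fintype.card ι := by exact_mod_cast Fintype.card_pos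
  by_cases h1 : ∑ i, f i = 1
  · obtain ⟨j, hj⟩ : ∃ j, f j < 0 := by
      by_contra! h
      exact hf ⟨h, h1⟩
    set s : ℝ := max 0 ((M + Real.log (Fintype.card ι) + 1) / (-f j)) with hs
    refine ⟨fun i => if i = j then Real.exp (-s) else 1, fun i => ?_, ?_⟩
    · dsimp only
      split_ifs
      exacts [Real.exp_pos _, one_pos]
    · have hsum : ∑ i, f i * Real.log (if i = j then Real.exp (-s) else 1) = -f j * s := by
        rw [Finset.sum_eq_single j]
        · rw [if_pos rfl, Real.log_exp]
          ring
        · intro i _ hij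
          rw [if_neg hij, Real.log_one, mul_zero]
        · simp
      have hpos : 0 < ∑ i, (if i = j then Real.exp (-s) else 1) := by
        refine Finset.sum_pos (fun i _ => ?_) Finset.univ_nonempty
        split_ifs
        exacts [Real.exp_pos _, one_pos]
      have hle : ∑ i, (if i = j then Real.exp (-s) else 1) ≤ (Fintype.card ι : ℝ) := by
        calc _ ≤ ∑ _i : ι, (1 : ℝ) := by
              refine Finset.sum_le_sum fun i _ => ?_
              split_ifs
              · exact Real.exp_le_one_iff.2 (neg_nonpos.2 (le_max_left _ _))
              · exact le_rfl
          _ = _ := by simp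
      have hlog := Real.log_le_log hpos hle
      have hs' : (M + Real.log (Fintype.card ι) + 1) / (-f j) ≤ s := le_max_right _ _
      rw [div_le_iff₀ (neg_pos.2 hj)] at hs'
      rw [hsum]
      linarith
  · have hne : ∑ i, f i - 1 ≠ 0 := sub_ne_zero.2 h1
    set s : ℝ := (M + Real.log (Fintype.card ι) + 1) / (∑ i, f i - 1) with hs
    refine ⟨fun _ => Real.exp s, fun _ => Real.exp_pos s, ?_⟩
    have hs' : s * (∑ i, f i - 1) = M + Real.log (Fintype.card ι) + 1 := div_mul_cancel₀ _ hne
    rw [← Finset.sum_mul, Finset.sum_const, Finset.card_univ, nsmul_eq_mul,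
      Real.log_mul hc.ne' (Real.exp_pos s).ne', Real.log_exp]
    linarith

/-- On the probability simplex `∑ fᵢ log fᵢ` is approached by the functional
`∑ fᵢ log yᵢ - log ∑ yᵢ`. -/
theorem exists_lt_sum_mul_log_sub_log_sum_of_lt {ι : Type*} [Fintype ι] {f : ι → ℝ}
    (hf : ∀ i, 0 ≤ f i) (hf1 : ∑ i, f i = 1) {z : ℝ} (hz : z < ∑ i, f i * Real.log (f i)) :
    ∃ y : ι → ℝ, (∀ i, 0 < y i) ∧ z < ∑ i, f i * Real.log (y i) - Real.log (∑ i, y i) := by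
  set n : ℝ := (Fintype.card ι : ℝ) with hn
  set δ := ∑ i, f i * Real.log (f i) - z with hδ
  have hδpos : 0 < δ := sub_pos.2 hz
  have hn0 : 0 ≤ n := Nat.cast_nonneg _
  set ε := δ / (n + 1) with hε
  have hεpos : 0 < ε := by positivity
  refine ⟨fun i => f i + ε, fun i => add_pos_of_nonneg_of_pos (hf i) hεpos, ?_⟩
  have hle : ∑ i, f i * Real.log (f i) ≤ ∑ i, f i * Real.log (f i + ε) := by
    refine Finset.sum_le_sum fun i _ => ?_
    rcases (hf i).eq_or_lt with h0 | hpos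
    · simp [← h0]
    · exact mul_le_mul_of_nonneg_left (Real.log_le_log hpos (by linarith)) hpos.le
  have hsum : ∑ i, (f i + ε) = 1 + n * ε := by
    rw [Finset.sum_add_distrib, hf1, Finset.sum_const, Finset.card_univ, nsmul_eq_mul]
  have hlog : Real.log (1 + n * ε) ≤ n * ε := by
    have := Real.log_le_sub_one_of_pos (show 0 < 1 + n * ε by positivity)
    linarith
  have hεδ : n * ε < δ := by
    have : (n + 1) * ε = δ := mul_div_cancel₀ _ (by positivity)
    linarith
  rw [hsum]
  linarith

theorem sum_range_mul_sub_eq {F e : ℕ → ℝ} (h0 : e 0 = 0) {n : ℕ}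
    (h : ∀ i, i + 1 ≤ n → F i * e (i + 1) = F (i + 1) * e (i + 1)) :
    ∑ i ∈ Finset.range (n + 1), F i * (e (i + 1) - e i) = F n * e (n + 1) := by
  induction n with
  | zero => simp [h0]
  | succ k ih =>
    rw [Finset.sum_range_succ, ih fun i hi => h i (by omega), h k le_rfl]
    ring

/-- The weighted sum of logarithmic ratios of leading minors does not depend on the choice of
the ordered diagonalization. -/
theorem IsOrderedDiagonalization.sum_mul_log_leadingMinor_eq {d : ℕ} {ρ x h h' : Mat d}
    {f : Fin d → ℝ} (hρ : ρ.PosDef) (hx : IsOrderedDiagonalization x h f)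
    (hx' : IsOrderedDiagonalization x h' f) :
    ∑ i : Fin d, f i * Real.log ((leadingMinor (hᴴ * ρ * h) (i + 1) i.isLt).re
        / (leadingMinor (hᴴ * ρ * h) i (le_of_lt i.isLt)).re)
      = ∑ i : Fin d, f i * Real.log ((leadingMinor (h'ᴴ * ρ * h') (i + 1) i.isLt).re
        / (leadingMinor (h'ᴴ * ρ * h') i (le_of_lt i.isLt)).re) := by
  have h1 : h * hᴴ = 1 := Matrix.mem_unitaryGroup_iff.1 hx.1
  have h2 : hᴴ * h = 1 := Matrix.mem_unitaryGroup_iff'.1 hx.1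
  have h1' : h' * h'ᴴ = 1 := Matrix.mem_unitaryGroup_iff.1 hx'.1
  have h2' : h'ᴴ * h' = 1 := Matrix.mem_unitaryGroup_iff'.1 hx'.1
  set u : Mat d := hᴴ * h' with hu
  have huu : uᴴ * u = 1 := by
    calc _ = h'ᴴ * (h * hᴴ) * h' := by
          rw [hu, Matrix.conjTranspose_mul, Matrix.conjTranspose_conjTranspose]
          simp only [Matrix.mul_assoc]
      _ = 1 := by rw [h1, Matrix.mul_one, h2']
  have hconj : h'ᴴ * ρ * h' = uᴴ * (hᴴ * ρ * h) * u := by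
    calc _ = h'ᴴ * (h * hᴴ) * ρ * (h * hᴴ) * h' := by rw [h1, Matrix.mul_one, Matrix.mul_one]
      _ = _ := by
          rw [hu, Matrix.conjTranspose_mul, Matrix.conjTranspose_conjTranspose]
          simp only [Matrix.mul_assoc]
  have hcomm : Matrix.diagonal (fun i => (f i : ℂ)) * u
      = u * Matrix.diagonal (fun i => (f i : ℂ)) := by
    have hxx : h * Matrix.diagonal (fun i => (f i : ℂ)) * hᴴ
        = h' * Matrix.diagonal (fun i => (f i : ℂ)) * h'ᴴ := hx.2.2.symm.trans hx'.2.2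
    calc _ = (hᴴ * h) * Matrix.diagonal (fun i => (f i : ℂ)) * u := by rw [h2, Matrix.one_mul]
      _ = hᴴ * (h * Matrix.diagonal (fun i => (f i : ℂ)) * hᴴ) * h' := by
          simp only [hu, Matrix.mul_assoc]
      _ = u * Matrix.diagonal (fun i => (f i : ℂ)) * (h'ᴴ * h') := by
          rw [hxx]
          simp only [hu, Matrix.mul_assoc]
      _ = _ := by rw [h2', Matrix.mul_one]
  have hzero : ∀ a b, f a ≠ f b → u a b = 0 := by
    intro a b hab
    have hent := congrFun (congrFun hcomm a) b
    rw [Matrix.diagonal_mul, Matrix.mul_diagonal, mul_comm (u a b)] at hent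
    by_contra hne
    exact hab (by exact_mod_cast mul_right_cancel₀ hne hent)
  have hσ : (hᴴ * ρ * h).PosDef := hρ.conjTranspose_mul_mul_same
    (Matrix.mulVec_injective_of_isUnit ((Matrix.isUnit_iff_isUnit_det h).2
      (Matrix.isUnit_det_of_left_inverse h2)))
  have hσ' : (h'ᴴ * ρ * h').PosDef := hρ.conjTranspose_mul_mul_same
    (Matrix.mulVec_injective_of_isUnit ((Matrix.isUnit_iff_isUnit_det h').2
      (Matrix.isUnit_det_of_left_inverse h2')))
  let F : ℕ → ℝ := fun i => if hi : i < d then f ⟨i, hi⟩ else 0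
  let e : ℕ → ℝ := fun i => if hi : i ≤ d then
    Real.log (leadingMinor (hᴴ * ρ * h) i hi).re - Real.log (leadingMinor (h'ᴴ * ρ * h') i hi).re
    else 0
  have hminor : ∀ i (hi : i ≤ d), (∀ k b : Fin d, (b : ℕ) < i → i ≤ (k : ℕ) → u k b = 0) →
      e i = 0 := by
    intro i hi hk
    simp only [e, dif_pos hi]
    rw [hconj, leadingMinor_unitary_conj _ huu hi hk, sub_self]
  have he0 : e 0 = 0 := hminor 0 (Nat.zero_le d) fun k b hb _ => absurd hb (Nat.not_lt_zero _)
  have hed : e d = 0 := hminor d le_rfl fun k b _ hk => absurd k.isLt (not_lt.2 hk)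
  rw [← sub_eq_zero, ← Finset.sum_sub_distrib]
  have hF : ∀ i : Fin d, f i * Real.log ((leadingMinor (hᴴ * ρ * h) (i + 1) i.isLt).re
        / (leadingMinor (hᴴ * ρ * h) i (le_of_lt i.isLt)).re)
      - f i * Real.log ((leadingMinor (h'ᴴ * ρ * h') (i + 1) i.isLt).re
        / (leadingMinor (h'ᴴ * ρ * h') i (le_of_lt i.isLt)).re)
      = F i * (e (i + 1) - e i) := by
    intro i
    have hi : (i : ℕ) + 1 ≤ d := i.isLt
    rw [Real.log_div (leadingMinor_re_pos hσ _).ne' (leadingMinor_re_pos hσ _).ne',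
      Real.log_div (leadingMinor_re_pos hσ' _).ne' (leadingMinor_re_pos hσ' _).ne']
    simp only [F, e, dif_pos i.isLt, dif_pos hi, dif_pos (le_of_lt i.isLt), Fin.eta]
    ring
  rw [Finset.sum_congr rfl fun i _ => hF i, Fin.sum_univ_eq_sum_range
    (fun i => F i * (e (i + 1) - e i)) d]
  rcases d with _ | n
  · simp
  rw [sum_range_mul_sub_eq he0, hed, mul_zero]
  intro i hi
  by_cases hff : F i = F (i + 1)
  · rw [hff]
  have hi1 : i + 1 < n + 1 := by omega
  have hi0 : i < n + 1 := by omega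
  rw [hminor (i + 1) hi1.le, mul_zero, mul_zero]
  intro k b hb hk
  apply hzero
  simp only [F, dif_pos hi0, dif_pos hi1] at hff
  have h3 : f ⟨i, hi0⟩ ≤ f b := hx.2.1 (Fin.le_def.2 (by simp; omega))
  have h4 : f k ≤ f ⟨i + 1, hi1⟩ := hx.2.1 (Fin.le_def.2 hk)
  have h5 : f ⟨i + 1, hi1⟩ ≤ f ⟨i, hi0⟩ := hx.2.1 (Fin.le_def.2 (by simp))
  exact ((h4.trans_lt (lt_of_le_of_ne h5 (Ne.symm hff))).trans_le h3).ne

theorem stmt16 (d : ℕ) (hd : 1 ≤ d) (ρ : Mat d) (hρ : ρ.PosDef) (hρ1 : Matrix.trace ρ = 1)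
    (h : Mat d) (hh : h ∈ Matrix.unitaryGroup (Fin d) ℂ)
    (f : Fin d → ℝ) (hf : Antitone f) :
    ((∀ i, 0 ≤ f i) ∧ ∑ i, f i = 1 →
      rate ρ (h * Matrix.diagonal (fun i => (f i : ℂ)) * star h)
        = ((∑ i : Fin d, (f i * Real.log (f i)
            - f i * Real.log ((leadingMinor (star h * ρ * h) (i + 1) i.isLt).re
                / (leadingMinor (star h * ρ * h) i (le_of_lt i.isLt)).re)) : ℝ) : EReal))
    ∧ (¬((∀ i, 0 ≤ f i) ∧ ∑ i, f i = 1) →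
        rate ρ (h * Matrix.diagonal (fun i => (f i : ℂ)) * star h) = ⊤) := by
  have : Nonempty (Fin d) := ⟨⟨0, hd⟩⟩
  have hx : IsOrderedDiagonalization (h * Matrix.diagonal (fun i => (f i : ℂ)) * star h) h f :=
    ⟨hh, hf, rfl⟩
  set x := h * Matrix.diagonal (fun i => (f i : ℂ)) * star h
  obtain ⟨h', hspec, hx'⟩ := exists_specPair_eq hx
  have hσ' : (h'ᴴ * ρ * h').PosDef := hρ.conjTranspose_mul_mul_same
    (Matrix.mulVec_injective_of_isUnit ((Matrix.isUnit_iff_isUnit_det h').2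
      (Matrix.isUnit_det_of_left_inverse (Matrix.mem_unitaryGroup_iff'.1 hx'.1))))
  obtain ⟨U, D, hU, hD, hσ⟩ := exists_unitUpperTriangular_conj_diagonal hσ'
  constructor
  · rintro ⟨hf0, hf1⟩
    have hval : ∑ i : Fin d, (f i * Real.log (f i)
            - f i * Real.log ((leadingMinor (star h * ρ * h) (i + 1) i.isLt).re
                / (leadingMinor (star h * ρ * h) i (le_of_lt i.isLt)).re))
        = ∑ i, (f i * Real.log (f i) - f i * Real.log (D i)) := by
      rw [Finset.sum_sub_distrib, Finset.sum_sub_distrib, Matrix.star_eq_conjTranspose,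
        hx.sum_mul_log_leadingMinor_eq hρ hx']
      simp only [leadingMinor_ratio hU hD hσ]
    rw [hval]
    refine le_antisymm (iSup_le fun g => EReal.coe_le_coe_iff.2 ?_)
      (EReal.ge_of_forall_gt_iff_ge.1 fun z hz => ?_)
    · obtain ⟨b, hb, hle⟩ := exists_rate_term_le hd hspec hx'.1 hU hD hσ g
      exact hle.trans (gibbs_inequality hf0 hf1 hb hD)
    · rw [EReal.coe_lt_coe_iff, Finset.sum_sub_distrib, lt_sub_iff_add_lt] at hz
      obtain ⟨y, hy, hlt⟩ := exists_lt_sum_mul_log_sub_log_sum_of_lt hf0 hf1 hz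
      obtain ⟨g, hg⟩ := exists_rate_term_eq_log hspec hx'.1 hU hD hσ hy
      refine le_iSup_of_le g (EReal.coe_le_coe_iff.2 ?_)
      rw [hg]
      linarith
  · intro hf'
    refine (EReal.eq_top_iff_forall_lt _).2 fun z => ?_
    obtain ⟨y, hy, hlt⟩ :=
      exists_lt_sum_mul_log_sub_log_sum hf' (z + ∑ i, f i * Real.log (D i))
    obtain ⟨g, hg⟩ := exists_rate_term_eq_log hspec hx'.1 hU hD hσ hy
    refine lt_iSup_iff.2 ⟨g, EReal.coe_lt_coe_iff.2 ?_⟩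
    rw [hg]
    linarith

end
end
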